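/- Let Γ be a simple graph, A = A(Γ) the associated right-angled Artin group, and H a subgroup of A. Then the quotient of H by its center Z = Subgroup.center H is a group with trivial center: the center of H / Z is the trivial subgroup. -/

import Mathlib

/-- The set of defining relators of the right-angled Artin group on `Γ`. -/
abbrev raagRels {V : Type*} (Γ : SimpleGraph V) : Set (FreeGroup V) :=
  {r | ∃ u v : V, Γ.Adj u v ∧
    r = FreeGroup.of u * FreeGroup.of v * (FreeGroup.of u)⁻¹ * (FreeGroup.of v)⁻¹}

/-- The right-angled Artin group associated to a simple graph `Γ`. -/
abbrev RAAG {V : Type*} (Γ : SimpleGraph V) := PresentedGroup (raagRels Γ)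

open scoped commutatorElement

theorem pow_mul_pow_of_mul_eq {G : Type*} [Group G] {g h c : G} (hg : Commute c g)
    (hh : Commute c h) (H : g * h = c * h * g) (n m : ℕ) :
    g ^ n * h ^ m = c ^ (n * m) * h ^ m * g ^ n := by
  have key : ∀ n : ℕ, g ^ n * h = c ^ n * h * g ^ n := by
    intro n
    induction n with
    | zero => simp
    | succ n ih =>
      calc g ^ (n + 1) * h = g ^ n * (g * h) := by rw [pow_succ, mul_assoc]
        _ = (g ^ n * c) * h * g := by rw [H]; simp only [mul_assoc]
        _ = c * (g ^ n * h) * g := by rw [← (hg.pow_right n).eq]; simp only [mul_assoc]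
        _ = c ^ (n + 1) * h * g ^ (n + 1) := by
          rw [ih, pow_succ' c, pow_succ g]; simp only [mul_assoc]
  induction m with
  | zero => simp
  | succ m ih =>
    calc g ^ n * h ^ (m + 1) = (g ^ n * h ^ m) * h := by rw [pow_succ, mul_assoc]
      _ = c ^ (n * m) * h ^ m * (g ^ n * h) := by rw [ih]; simp only [mul_assoc]
      _ = c ^ (n * m) * (h ^ m * c ^ n) * h * g ^ n := by rw [key]; simp only [mul_assoc]
      _ = c ^ (n * (m + 1)) * h ^ (m + 1) * g ^ n := by
        rw [((hh.pow_left n).pow_right m).symm.eq, mul_add, mul_one, pow_add, pow_succ]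
        simp only [mul_assoc]

/-- Commutators in `G` that are central in the subgroup generated by their two entries are
trivial; equivalently, no nonabelian quotient of the Heisenberg group embeds in `G`. -/
def HasNoCentralCommutators (G : Type*) [Group G] : Prop :=
  ∀ g h : G, Commute ⁅g, h⁆ g → Commute ⁅g, h⁆ h → ⁅g, h⁆ = 1

namespace HNNExtension

open NormalWord

variable {G : Type*} [Group G] {A B : Subgroup G} {φ : A ≃* B}

variable (φ) in
/-- The element of an HNN extension spelled by a list of syllables `t ^ u * g`. -/
def prodList (l : List (ℤˣ × G)) : HNNExtension G A B φ :=
  (l.map (fun x => t ^ (x.1 : ℤ) * of x.2)).prod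

theorem prodList_append (l₁ l₂ : List (ℤˣ × G)) :
    prodList φ (l₁ ++ l₂) = prodList φ l₁ * prodList φ l₂ := by
  simp [prodList]

theorem prodList_append_singleton_mul_of (l : List (ℤˣ × G)) (a : ℤˣ × G) (g : G) :
    prodList φ (l ++ [(a.1, a.2 * g)]) = prodList φ (l ++ [a]) * of g := by
  simp [prodList, mul_assoc]

theorem prodList_flatten_replicate (l : List (ℤˣ × G)) (n : ℕ) :
    prodList φ (List.replicate n l).flatten = prodList φ l ^ n := by
  induction n with
  | zero => simp [prodList]
  | succ n ih => rw [List.replicate_succ, List.flatten_cons, prodList_append, ih, pow_succ']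

theorem t_zpow_mul_of_mul_t_zpow_neg (u : ℤˣ) {g : G} (hg : g ∈ toSubgroup A B u) :
    ∃ g' : G, (t ^ (u : ℤ) * of g * t ^ (-u : ℤ) : HNNExtension G A B φ) = of g' := by
  rcases Int.units_eq_one_or u with rfl | rfl
  · exact ⟨φ ⟨g, hg⟩, by simpa using (equiv_eq_conj (φ := φ) ⟨g, hg⟩).symm⟩
  · exact ⟨φ.symm ⟨g, hg⟩, by simpa using (equiv_symm_eq_conj (φ := φ) ⟨g, hg⟩).symm⟩

theorem isConj_prodList_append_comm (l₁ l₂ : List (ℤˣ × G)) :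
    IsConj (prodList φ (l₁ ++ l₂)) (prodList φ (l₂ ++ l₁)) := by
  rw [prodList_append, prodList_append, isConj_iff]
  exact ⟨(prodList φ l₁)⁻¹, by group⟩

/-- The relation between consecutive syllables of a reduced word. -/
def NoPinch (A B : Subgroup G) (a b : ℤˣ × G) : Prop :=
  a.2 ∈ toSubgroup A B a.1 → a.1 = b.1

theorem exists_shorter_of_pinch {a b : ℤˣ × G} (h : ¬ NoPinch A B a b) (l : List (ℤˣ × G)) :
    (∃ g, IsConj (prodList φ (l ++ [a, b])) (of g)) ∨
      ∃ l', l'.length < (l ++ [a, b]).length ∧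
        IsConj (prodList φ (l ++ [a, b])) (prodList φ l') := by
  simp only [NoPinch, Classical.not_imp] at h
  obtain ⟨ha, hab⟩ := h
  have hb : (b.1 : ℤ) = -(a.1 : ℤ) := by
    rw [Int.units_ne_iff_eq_neg.1 hab, Units.val_neg, neg_neg]
  obtain ⟨g', hg'⟩ := t_zpow_mul_of_mul_t_zpow_neg (φ := φ) a.1 ha
  have hprod : prodList φ [a, b] = of (g' * b.2) := by
    simp only [prodList, List.map_cons, List.map_nil, List.prod_cons, List.prod_nil, mul_one]
    rw [hb, map_mul, ← hg']
    simp only [mul_assoc]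
  rcases List.eq_nil_or_concat l with rfl | ⟨l, e, rfl⟩
  · exact .inl ⟨_, by rw [List.nil_append, hprod]⟩
  · refine .inr ⟨l ++ [(e.1, e.2 * (g' * b.2))], by simp, ?_⟩
    rw [prodList_append, hprod, prodList_append_singleton_mul_of, List.concat_eq_append]

theorem exists_cyclicallyReduced_prodList (l : List (ℤˣ × G)) :
    (∃ g, IsConj (prodList φ l) (of g)) ∨
      ∃ l' : List (ℤˣ × G), l' ≠ [] ∧ l'.IsChain (NoPinch A B) ∧
        (∀ a ∈ l'.getLast?, ∀ b ∈ l'.head?, NoPinch A B a b) ∧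
        IsConj (prodList φ l) (prodList φ l') := by
  induction hn : l.length using Nat.strong_induction_on generalizing l with
  | _ n ih =>
  subst hn
  have reduce : ∀ l₁ a b, ¬ NoPinch A B a b → (l₁ ++ [a, b]).length = l.length →
      IsConj (prodList φ l) (prodList φ (l₁ ++ [a, b])) →
      (∃ g, IsConj (prodList φ l) (of g)) ∨
      ∃ l' : List (ℤˣ × G), l' ≠ [] ∧ l'.IsChain (NoPinch A B) ∧
        (∀ a ∈ l'.getLast?, ∀ b ∈ l'.head?, NoPinch A B a b) ∧
        IsConj (prodList φ l) (prodList φ l') := by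
    intro l₁ a b hab hlen hconj
    rcases exists_shorter_of_pinch (φ := φ) hab l₁ with ⟨g, hg⟩ | ⟨l', hl', hc⟩
    · exact .inl ⟨g, hconj.trans hg⟩
    · rcases ih _ (hlen ▸ hl') l' rfl with ⟨g, hg⟩ | ⟨l'', h1, h2, h3, h4⟩
      · exact .inl ⟨g, (hconj.trans hc).trans hg⟩
      · exact .inr ⟨l'', h1, h2, h3, (hconj.trans hc).trans h4⟩
  rcases eq_or_ne l [] with rfl | hl
  · exact .inl ⟨1, by simp [prodList]⟩
  by_cases hchain : l.IsChain (NoPinch A B)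
  · by_cases hcyc : ∀ a ∈ l.getLast?, ∀ b ∈ l.head?, NoPinch A B a b
    · exact .inr ⟨l, hl, hchain, hcyc, .refl _⟩
    · simp only [not_forall] at hcyc
      obtain ⟨a, ha, b, hb, hab⟩ := hcyc
      obtain ⟨l₁, rfl⟩ := List.head?_eq_some_iff.1 hb
      rcases List.eq_nil_or_concat l₁ with rfl | ⟨l₂, e, rfl⟩
      · obtain rfl : b = a := by simpa using ha
        exact absurd (fun _ => rfl : NoPinch A B b b) hab
      · obtain rfl : e = a := by simpa [List.getLast?_cons] using ha
        refine reduce l₂ e b hab (by simp) ?_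
        simpa using isConj_prodList_append_comm (φ := φ) [b] (l₂ ++ [e])
  · rw [List.isChain_iff_getElem] at hchain
    simp only [not_forall] at hchain
    obtain ⟨i, hi, hab⟩ := hchain
    have hsplit : l = l.take i ++ ([l[i], l[i + 1]] ++ l.drop (i + 2)) := by
      simp
    refine reduce (l.drop (i + 2) ++ l.take i) _ _ hab ?_ ?_
    · simp; omega
    · have := isConj_prodList_append_comm (φ := φ)
        (l.take i ++ [l[i], l[i + 1]]) (l.drop (i + 2))
      rw [List.append_assoc, ← hsplit] at this
      simpa using this

theorem exists_cyclicallyReduced (x : HNNExtension G A B φ) :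
    (∃ g, IsConj x (of g)) ∨
      ∃ l : List (ℤˣ × G), l ≠ [] ∧ l.IsChain (NoPinch A B) ∧
        (∀ a ∈ l.getLast?, ∀ b ∈ l.head?, NoPinch A B a b) ∧ IsConj x (prodList φ l) := by
  obtain ⟨d⟩ := TransversalPair.nonempty G A B
  obtain ⟨w, rfl⟩ := (NormalWord.equiv φ d).symm.surjective x
  change (∃ g, IsConj (of w.head * prodList φ w.toList) (of g)) ∨ ∃ l : List (ℤˣ × G), l ≠ [] ∧
    l.IsChain (NoPinch A B) ∧ (∀ a ∈ l.getLast?, ∀ b ∈ l.head?, NoPinch A B a b) ∧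
    IsConj (of w.head * prodList φ w.toList) (prodList φ l)
  rcases List.eq_nil_or_concat w.toList with h | ⟨l, e, h⟩
  · exact .inl ⟨w.head, by simp only [h, prodList, List.map_nil, List.prod_nil, mul_one]; exact .refl _⟩
  · have hc : IsConj (of w.head * prodList φ w.toList)
        (prodList φ (l ++ [(e.1, e.2 * w.head)])) := by
      rw [prodList_append_singleton_mul_of, h, isConj_iff]
      exact ⟨(of w.head)⁻¹, by simp⟩
    rcases exists_cyclicallyReduced_prodList (φ := φ) (l ++ [(e.1, e.2 * w.head)]) with
      ⟨g, hg⟩ | ⟨l', h1, h2, h3, h4⟩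
    · exact .inl ⟨g, hc.trans hg⟩
    · exact .inr ⟨l', h1, h2, h3, hc.trans h4⟩

variable {d : TransversalPair G A B}

theorem length_toList_unitsSMul_le (u : ℤˣ) (w : NormalWord d) :
    (unitsSMul φ u w).toList.length ≤ w.toList.length + 1 := by
  unfold unitsSMul
  split_ifs with h
  · cases w using consRecOn with
    | ofGroup => simp [Cancels] at h
    | cons g u' w h1 h2 => simp [unitsSMulWithCancel]; omega
  · simp

/-- Multiplication by a fixed element changes the number of stable letters boundedly. -/
theorem exists_length_smul_le (x : HNNExtension G A B φ) :
    ∃ K : ℕ, ∀ w : NormalWord d, (x • w).toList.length ≤ w.toList.length + K ∧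
      (x⁻¹ • w).toList.length ≤ w.toList.length + K := by
  induction x using induction_on with
  | of g => exact ⟨0, fun w => by simp [← map_inv, of_smul_eq_smul]⟩
  | t =>
    refine ⟨1, fun w => ⟨?_, ?_⟩⟩
    · rw [t_smul_eq_unitsSMul]; exact length_toList_unitsSMul_le 1 w
    · have := t_pow_smul_eq_unitsSMul (φ := φ) (-1) w
      simp only [Units.val_neg, Units.val_one, Int.reduceNeg, zpow_neg, zpow_one] at this
      rw [this]; exact length_toList_unitsSMul_le (-1) w
  | mul x y hx hy =>
    obtain ⟨K, hK⟩ := hx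
    obtain ⟨L, hL⟩ := hy
    refine ⟨K + L, fun w => ⟨?_, ?_⟩⟩
    · rw [mul_smul]
      have := (hK (y • w)).1
      have := (hL w).1
      omega
    · rw [mul_inv_rev, mul_smul]
      have := (hL (x⁻¹ • w)).2
      have := (hK w).2
      omega
  | inv x hx =>
    obtain ⟨K, hK⟩ := hx
    exact ⟨K, fun w => ⟨(hK w).2, by simpa using (hK w).1⟩⟩

theorem length_pow_smul_le {x : HNNExtension G A B φ} {K : ℕ}
    (hK : ∀ w : NormalWord d, (x • w).toList.length ≤ w.toList.length + K) (n : ℕ)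
    (w : NormalWord d) : ((x ^ n) • w).toList.length ≤ w.toList.length + n * K := by
  induction n with
  | zero => simp
  | succ n ih =>
    rw [pow_succ', mul_smul, Nat.succ_mul]
    have := hK (x ^ n • w)
    omega

theorem length_prodList_smul_empty {l : List (ℤˣ × G)} (hl : l.IsChain (NoPinch A B)) :
    (prodList φ l • (empty : NormalWord d)).toList.length = l.length := by
  obtain ⟨w, hw, hlen, -⟩ := ReducedWord.exists_normalWord_prod_eq φ d ⟨1, l, hl⟩
  have h : w.prod φ = prodList φ l := by rw [hw]; simp [ReducedWord.prod, prodList]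
  rw [← h, prod_smul_empty]
  simpa using congrArg List.length hlen

theorem le_length_prodList_pow_smul_empty {l : List (ℤˣ × G)} (hne : l ≠ [])
    (hl : l.IsChain (NoPinch A B))
    (hcyc : ∀ a ∈ l.getLast?, ∀ b ∈ l.head?, NoPinch A B a b) (n : ℕ) :
    n ≤ (prodList φ l ^ n • (empty : NormalWord d)).toList.length := by
  have hchain : (List.replicate n l).flatten.IsChain (NoPinch A B) := by
    rw [List.isChain_flatten (by simp [hne.symm])]
    exact ⟨fun l' h => (List.eq_of_mem_replicate h) ▸ hl, List.isChain_replicate_of_rel _ hcyc⟩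
  rw [← prodList_flatten_replicate, length_prodList_smul_empty hchain]
  simpa using Nat.le_mul_of_pos_right n (List.length_pos_iff.2 hne)

/-- A commutator commuting with both of its entries is elliptic in an HNN extension. -/
theorem exists_isConj_of_commutator {g h : HNNExtension G A B φ} (hg : Commute ⁅g, h⁆ g)
    (hh : Commute ⁅g, h⁆ h) : ∃ b, IsConj ⁅g, h⁆ (of b) := by
  refine (exists_cyclicallyReduced ⁅g, h⁆).resolve_right ?_
  rintro ⟨l, hne, hl, hcyc, hconj⟩
  obtain ⟨d⟩ := TransversalPair.nonempty G A B
  obtain ⟨p, hp⟩ := isConj_iff.1 hconj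
  obtain ⟨Kg, hKg⟩ := exists_length_smul_le (d := d) g
  obtain ⟨Kh, hKh⟩ := exists_length_smul_le (d := d) h
  obtain ⟨Kp, hKp⟩ := exists_length_smul_le (d := d) p
  have hbound : ∀ n : ℕ, n * n ≤ 2 * Kp + n * (2 * Kg + 2 * Kh) := by
    intro n
    have hpow : prodList φ l ^ (n * n) = p * (g ^ n * (h ^ n * (g⁻¹ ^ n * (h⁻¹ ^ n * p⁻¹)))) := by
      have := pow_mul_pow_of_mul_eq hg hh (by simp [commutatorElement_def]) n n
      rw [← hp, conj_pow, inv_pow, inv_pow, eq_comm, mul_assoc p]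
      congr 1
      rw [← mul_assoc, this]
      group
    have h0 := le_length_prodList_pow_smul_empty (φ := φ) (d := d) hne hl hcyc (n * n)
    rw [hpow] at h0
    simp only [mul_smul] at h0
    have h1 := (hKp (empty : NormalWord d)).2
    have h2 := length_pow_smul_le (fun w => (hKh w).2) n (p⁻¹ • (empty : NormalWord d))
    have h3 := length_pow_smul_le (fun w => (hKg w).2) n (h⁻¹ ^ n • p⁻¹ • (empty : NormalWord d))
    have h4 := length_pow_smul_le (fun w => (hKh w).1) n
      (g⁻¹ ^ n • h⁻¹ ^ n • p⁻¹ • (empty : NormalWord d))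
    have h5 := length_pow_smul_le (fun w => (hKg w).1) n
      (h ^ n • g⁻¹ ^ n • h⁻¹ ^ n • p⁻¹ • (empty : NormalWord d))
    have h6 := (hKp (g ^ n • h ^ n • g⁻¹ ^ n • h⁻¹ ^ n • p⁻¹ • (empty : NormalWord d))).1
    simp only [empty_toList, List.length_nil] at h1
    linarith
  have := hbound (2 * Kp + (2 * Kg + 2 * Kh) + 1)
  nlinarith

theorem hasNoCentralCommutators_refl (C : Subgroup G) (hG : HasNoCentralCommutators G) :
    HasNoCentralCommutators (HNNExtension G C C (MulEquiv.refl C)) := by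
  intro g h hg hh
  obtain ⟨b, hb⟩ := exists_isConj_of_commutator hg hh
  obtain ⟨p, hp⟩ := isConj_iff.1 hb
  let r : HNNExtension G C C (MulEquiv.refl C) →* G := lift (MonoidHom.id G) 1 (by simp)
  have hrc : ⁅r g, r h⁆ = 1 := by
    refine hG _ _ ?_ ?_ <;> rw [← map_commutatorElement]
    exacts [hg.map r, hh.map r]
  have hrb : r (of b) = b := by simp [r]
  rw [← hp, map_mul, map_mul, map_commutatorElement, hrc, map_inv, mul_one, mul_inv_cancel] at hrb
  rwa [← hrb, map_one, conj_eq_one_iff] at hp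

end HNNExtension

namespace RAAG

variable {V : Type*} (Γ : SimpleGraph V)

/-- The standard generators of a right-angled Artin group. -/
def gen (v : V) : RAAG Γ := PresentedGroup.of v

variable {Γ}

theorem gen_commute {u v : V} (h : Γ.Adj u v) : Commute (gen Γ u) (gen Γ v) := by
  have := PresentedGroup.one_of_mem (rels := raagRels Γ) ⟨u, v, h, rfl⟩
  rw [← commutatorElement_eq_one_iff_commute]
  simpa [commutatorElement_def, gen, PresentedGroup.of] using this

/-- The homomorphism out of a right-angled Artin group determined by images of the generators
that commute for adjacent vertices. -/
def lift {K : Type*} [Group K] (f : V → K) (hf : ∀ u v, Γ.Adj u v → Commute (f u) (f v)) :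
    RAAG Γ →* K :=
  PresentedGroup.toGroup (f := f) (by
    rintro _ ⟨u, v, h, rfl⟩
    simpa [commutatorElement_def] using commutatorElement_eq_one_iff_commute.2 (hf u v h))

@[simp]
theorem lift_gen {K : Type*} [Group K] (f : V → K)
    (hf : ∀ u v, Γ.Adj u v → Commute (f u) (f v)) (v : V) : lift f hf (gen Γ v) = f v :=
  PresentedGroup.toGroup.of _

theorem closure_range_gen : Subgroup.closure (Set.range (gen Γ)) = ⊤ :=
  PresentedGroup.closure_range_of _

variable (Γ) in
/-- The subgroup generated by a set of vertices. -/
def special (S : Set V) : Subgroup (RAAG Γ) := Subgroup.closure (gen Γ '' S)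

theorem gen_mem_special {S : Set V} {v : V} (hv : v ∈ S) : gen Γ v ∈ special Γ S :=
  Subgroup.subset_closure ⟨v, hv, rfl⟩

theorem special_mono {S T : Set V} (h : S ⊆ T) : special Γ S ≤ special Γ T :=
  Subgroup.closure_mono (Set.image_mono h)

/-- The elements of a special subgroup that commute with the generator `v`. -/
def linkSubgroup (S : Set V) (v : V) : Subgroup (special Γ S) :=
  (Subgroup.centralizer {gen Γ v}).subgroupOf (special Γ S)

/-- The HNN extension of a special subgroup by a stable letter with the commutation relations
of `v`. -/
abbrev LinkHNN (Γ : SimpleGraph V) (S : Set V) (v : V) : Type _ :=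
  HNNExtension (special Γ S) (linkSubgroup S v) (linkSubgroup S v) (MulEquiv.refl _)

open Classical in
/-- The images of the generators in the HNN extension; vertices outside `insert v S` are killed. -/
noncomputable def toLinkHNNFun (S : Set V) (v u : V) : LinkHNN Γ S v :=
  if u = v then HNNExtension.t
  else if hu : u ∈ S then HNNExtension.of ⟨gen Γ u, gen_mem_special hu⟩ else 1

theorem commute_t_toLinkHNNFun {S : Set V} {u v : V} (h : Γ.Adj u v) :
    Commute HNNExtension.t (toLinkHNNFun (Γ := Γ) S v u) := by
  unfold toLinkHNNFun
  split_ifs with h1 h2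
  · exact Commute.refl _
  · refine HNNExtension.t_mul_of (φ := MulEquiv.refl (linkSubgroup S v))
      ⟨⟨gen Γ u, gen_mem_special h2⟩, ?_⟩
    rw [linkSubgroup, Subgroup.mem_subgroupOf, Subgroup.mem_centralizer_singleton_iff]
    exact gen_commute h
  · exact Commute.one_right _

theorem commute_toLinkHNNFun (S : Set V) (v : V) {a b : V} (h : Γ.Adj a b) :
    Commute (toLinkHNNFun (Γ := Γ) S v a) (toLinkHNNFun S v b) := by
  have ht : toLinkHNNFun (Γ := Γ) S v v = HNNExtension.t := by simp [toLinkHNNFun]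
  by_cases ha : a = v
  · subst ha
    rw [ht]
    exact commute_t_toLinkHNNFun h.symm
  by_cases hb : b = v
  · subst hb
    rw [ht]
    exact (commute_t_toLinkHNNFun h).symm
  unfold toLinkHNNFun
  rw [if_neg ha, if_neg hb]
  split_ifs
  · exact Commute.map (Subtype.ext (gen_commute h).eq) _
  all_goals simp

/-- The homomorphism from the right-angled Artin group to the HNN extension. -/
noncomputable def toLinkHNN (S : Set V) (v : V) : RAAG Γ →* LinkHNN Γ S v :=
  lift (toLinkHNNFun S v) fun _ _ h => commute_toLinkHNNFun S v h

/-- The homomorphism from the HNN extension back to the right-angled Artin group. -/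
def ofLinkHNN (S : Set V) (v : V) : LinkHNN Γ S v →* RAAG Γ :=
  HNNExtension.lift (special Γ S).subtype (gen Γ v) fun a =>
    (Subgroup.mem_centralizer_singleton_iff.1 (Subgroup.mem_subgroupOf.1 a.2)).symm

theorem ofLinkHNN_toLinkHNN {S : Set V} {v : V} {x : RAAG Γ} (hx : x ∈ special Γ (insert v S)) :
    ofLinkHNN S v (toLinkHNN S v x) = x := by
  suffices special Γ (insert v S) ≤
      ((ofLinkHNN S v).comp (toLinkHNN S v)).eqLocus (MonoidHom.id _) from this hx
  rw [special, Subgroup.closure_le]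
  rintro _ ⟨u, hu, rfl⟩
  change ofLinkHNN S v (toLinkHNN S v (gen Γ u)) = gen Γ u
  rw [toLinkHNN, lift_gen, toLinkHNNFun]
  split_ifs with h1 h2
  · rw [h1]
    exact HNNExtension.lift_t _ _ _
  · exact HNNExtension.lift_of _ _ _ _
  · exact absurd (hu.resolve_left h1) h2

theorem hasNoCentralCommutators_special_insert {S : Set V} (v : V)
    (hS : HasNoCentralCommutators (special Γ S)) :
    HasNoCentralCommutators (special Γ (insert v S)) := by
  let f : special Γ (insert v S) →* LinkHNN Γ S v := (toLinkHNN S v).comp (Subgroup.subtype _)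
  have hf : Function.Injective f := fun x y h => Subtype.ext <| by
    rw [← ofLinkHNN_toLinkHNN x.2, ← ofLinkHNN_toLinkHNN y.2]
    exact congrArg (ofLinkHNN S v) h
  intro g h hg hh
  apply hf
  rw [map_commutatorElement, map_one]
  refine HNNExtension.hasNoCentralCommutators_refl _ hS _ _ ?_ ?_ <;>
    rw [← map_commutatorElement]
  exacts [hg.map f, hh.map f]

theorem hasNoCentralCommutators_special (S : Finset V) :
    HasNoCentralCommutators (special Γ (S : Set V)) := by
  classical
  induction S using Finset.induction_on with
  | empty =>
    have : Subsingleton (special Γ ((∅ : Finset V) : Set V)) := by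
      simp only [special, Finset.coe_empty, Set.image_empty, Subgroup.closure_empty]
      infer_instance
    exact fun _ _ _ _ => Subsingleton.elim _ _
  | insert v S _ ih =>
    rw [Finset.coe_insert]
    exact hasNoCentralCommutators_special_insert v ih

theorem exists_finset_mem_special (x : RAAG Γ) : ∃ S : Finset V, x ∈ special Γ (S : Set V) := by
  classical
  have hx : x ∈ Subgroup.closure (Set.range (gen Γ)) := closure_range_gen ▸ Subgroup.mem_top x
  induction hx using Subgroup.closure_induction with
  | mem x hx =>
    obtain ⟨v, rfl⟩ := hx
    exact ⟨{v}, gen_mem_special (by simp)⟩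
  | one => exact ⟨∅, one_mem _⟩
  | mul x y _ _ hx hy =>
    obtain ⟨S, hS⟩ := hx
    obtain ⟨T, hT⟩ := hy
    exact ⟨S ∪ T, mul_mem (special_mono (by simp) hS) (special_mono (by simp) hT)⟩
  | inv x _ hx =>
    obtain ⟨S, hS⟩ := hx
    exact ⟨S, inv_mem hS⟩

variable (Γ) in
theorem hasNoCentralCommutators : HasNoCentralCommutators (RAAG Γ) := by
  classical
  intro g h hg hh
  obtain ⟨S, hS⟩ := exists_finset_mem_special g
  obtain ⟨T, hT⟩ := exists_finset_mem_special h
  have hS' : g ∈ special Γ ((S ∪ T : Finset V) : Set V) := special_mono (by simp) hS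
  have hT' : h ∈ special Γ ((S ∪ T : Finset V) : Set V) := special_mono (by simp) hT
  exact congrArg Subtype.val (hasNoCentralCommutators_special (S ∪ T) ⟨g, hS'⟩ ⟨h, hT'⟩
    (Subtype.ext hg.eq) (Subtype.ext hh.eq))

end RAAG

theorem HasNoCentralCommutators.subgroup {G : Type*} [Group G] (hG : HasNoCentralCommutators G)
    (H : Subgroup G) : HasNoCentralCommutators H := fun g h hg hh =>
  Subtype.ext (hG g h (hg.map H.subtype) (hh.map H.subtype))

theorem HasNoCentralCommutators.center_quotient_center_eq_bot {G : Type*} [Group G]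
    (hG : HasNoCentralCommutators G) : Subgroup.center (G ⧸ Subgroup.center G) = ⊥ := by
  rw [eq_bot_iff]
  intro x hx
  obtain ⟨g, rfl⟩ := QuotientGroup.mk_surjective x
  rw [Subgroup.mem_bot, QuotientGroup.eq_one_iff, Subgroup.mem_center_iff]
  intro h
  have hc : ⁅g, h⁆ ∈ Subgroup.center G := by
    rw [← QuotientGroup.eq_one_iff]
    exact commutatorElement_eq_one_iff_mul_comm.2 (Subgroup.mem_center_iff.1 hx h).symm
  have hcomm : ∀ k, Commute ⁅g, h⁆ k := fun k => (Subgroup.mem_center_iff.1 hc k).symm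
  exact (commutatorElement_eq_one_iff_mul_comm.1 (hG g h (hcomm g) (hcomm h))).symm

/-- The quotient of a subgroup of a right-angled Artin group by its center is
centerless. -/
theorem center_quotient_center_raag_subgroup_eq_bot
    {V : Type*} (Γ : SimpleGraph V) (H : Subgroup (RAAG Γ)) :
    Subgroup.center (H ⧸ Subgroup.center H) = ⊥ := by
  exact ((RAAG.hasNoCentralCommutators Γ).subgroup H).center_quotient_center_eq_bot
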